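/- arXiv:1812.08324 — 2 statements merged into one kernel-verified Lean document; each statement's English description precedes it below -/
import Mathlib

section
/- Let ε > 0 and D > 0, and let x, y, x̄ be real numbers with |x - x̄| ≤ D and |y - x̄| ≤ D. Let δ > 0 and let r be a natural number satisfying r > max{ log₂(e^{2ε²D²}/δ) - 1, 12ε²D² - 1 }. Then |e^{-ε²(x-y)²} - Σ_{n=0}^r α_n(x - x̄) β_n(y - x̄)| < δ, where α_n(t) = (2ⁿ ε^{2n} e^{-ε² t²} tⁿ)/n! and β_n(t) = e^{-ε² t²} tⁿ. -/
/-- A weak consequence of Stirling's lower bound for the factorial. -/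
lemma two_mul_div_three_pow_le_factorial {m : ℕ} (hm : 1 ≤ m) :
    2 * ((m : ℝ) / 3) ^ m ≤ (m.factorial : ℝ) := by
  have hm' : (1 : ℝ) ≤ m := by exact_mod_cast hm
  have hsqrt : 2 ≤ √(2 * Real.pi * m) := by
    apply Real.le_sqrt_of_sq_le
    nlinarith [Real.pi_gt_three]
  have he : Real.exp 1 ≤ 3 := by linarith [Real.exp_one_lt_d9]
  calc 2 * ((m : ℝ) / 3) ^ m ≤ √(2 * Real.pi * m) * (m / Real.exp 1) ^ m := by gcongr
    _ ≤ m.factorial := Stirling.le_factorial_stirling m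

/-- Taylor remainder bound for the real exponential, when `|s|` is small compared to the order. -/
lemma abs_exp_sub_sum_le_of_abs_le {s c : ℝ} {m : ℕ} (hm : 1 ≤ m) (hs : |s| ≤ c)
    (hc : 6 * c ≤ m) :
    |Real.exp s - ∑ n ∈ Finset.range m, s ^ n / (n.factorial : ℝ)| ≤ 1 / 2 ^ m := by
  have hs6 : |s| ≤ m / 3 / 2 := by linarith
  have hratio : ‖(s : ℂ)‖ / (m.succ : ℝ) ≤ 1 / 2 := by
    rw [Complex.norm_real, Real.norm_eq_abs, div_le_iff₀ (by positivity)]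
    push_cast
    have : (0 : ℝ) ≤ m := m.cast_nonneg
    linarith
  have hbound := Complex.exp_bound' hratio
  rw [Complex.norm_real, Real.norm_eq_abs] at hbound
  have hcast : Complex.exp s - ∑ n ∈ Finset.range m, (s : ℂ) ^ n / (n.factorial : ℂ) =
      ((Real.exp s - ∑ n ∈ Finset.range m, s ^ n / (n.factorial : ℝ) : ℝ) : ℂ) := by
    push_cast
    rfl
  rw [hcast, Complex.norm_real, Real.norm_eq_abs] at hbound
  refine hbound.trans ?_
  calc |s| ^ m / (m.factorial : ℝ) * 2 ≤ ((m : ℝ) / 3 / 2) ^ m / m.factorial * 2 := by gcongr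
    _ = 2 * ((m : ℝ) / 3) ^ m / m.factorial * (1 / 2 ^ m) := by
      rw [div_pow _ 2]
      ring
    _ ≤ 1 * (1 / 2 ^ m) := by
      gcongr
      exact div_le_one_of_le₀ (two_mul_div_three_pow_le_factorial hm) (by positivity)
    _ = 1 / 2 ^ m := one_mul _


/-- Truncation-error bound for the separable expansion of the Gaussian kernel:
if `r > max{log₂(e^{2ε²D²}/δ) - 1, 12ε²D² - 1}`, then
`|e^{-ε²(x-y)²} - Σ_{n=0}^r α_n(x-x̄) β_n(y-x̄)| < δ`. -/
theorem gaussian_kernel_truncation_bound (ε D δ : ℝ) (hε : 0 < ε) (hD : 0 < D) (hδ : 0 < δ)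
    (x y xb : ℝ) (hx : |x - xb| ≤ D) (hy : |y - xb| ≤ D) (r : ℕ)
    (hr : (r : ℝ) > max (Real.logb 2 (Real.exp (2 * ε ^ 2 * D ^ 2) / δ) - 1)
        (12 * ε ^ 2 * D ^ 2 - 1)) :
    |Real.exp (-ε ^ 2 * (x - y) ^ 2) -
        ∑ n ∈ Finset.range (r + 1),
          (2 ^ n * ε ^ (2 * n) * Real.exp (-ε ^ 2 * (x - xb) ^ 2) * (x - xb) ^ n /
              (Nat.factorial n : ℝ)) *
            (Real.exp (-ε ^ 2 * (y - xb) ^ 2) * (y - xb) ^ n)| < δ := by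
  set a := x - xb with ha
  set b := y - xb with hb
  obtain ⟨hlog, hlin⟩ := max_lt_iff.mp hr
  have hs : |2 * ε ^ 2 * (a * b)| ≤ 2 * ε ^ 2 * D ^ 2 := by
    rw [abs_mul, abs_of_pos (by positivity : 0 < 2 * ε ^ 2), abs_mul, sq D]
    gcongr
  have hrem := abs_exp_sub_sum_le_of_abs_le (m := r + 1) (by lia) hs (by push_cast; linarith)
  have hpow : Real.exp (2 * ε ^ 2 * D ^ 2) / δ < 2 ^ (r + 1) := by
    rw [← Real.rpow_natCast _ (r + 1), ← Real.logb_lt_iff_lt_rpow (by norm_num) (by positivity)]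
    push_cast
    linarith
  have hδ' : 1 / 2 ^ (r + 1) < δ := by
    have hone : 1 ≤ Real.exp (2 * ε ^ 2 * D ^ 2) := Real.one_le_exp (by positivity)
    rw [div_lt_iff₀ hδ] at hpow
    rw [div_lt_iff₀ (by positivity)]
    linarith
  have hfactor : Real.exp (-ε ^ 2 * (x - y) ^ 2) -
        ∑ n ∈ Finset.range (r + 1),
          (2 ^ n * ε ^ (2 * n) * Real.exp (-ε ^ 2 * a ^ 2) * a ^ n / (Nat.factorial n : ℝ)) *
            (Real.exp (-ε ^ 2 * b ^ 2) * b ^ n) =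
      Real.exp (-ε ^ 2 * a ^ 2 + -ε ^ 2 * b ^ 2) * (Real.exp (2 * ε ^ 2 * (a * b)) -
        ∑ n ∈ Finset.range (r + 1), (2 * ε ^ 2 * (a * b)) ^ n / (n.factorial : ℝ)) := by
    rw [mul_sub, ← Real.exp_add, Finset.mul_sum]
    congr 1
    · congr 1
      rw [ha, hb]
      ring
    · refine Finset.sum_congr rfl fun n _ => ?_
      rw [Real.exp_add, mul_pow, mul_pow, mul_pow, ← pow_mul]
      ring
  have hexp : Real.exp (-ε ^ 2 * a ^ 2 + -ε ^ 2 * b ^ 2) ≤ 1 := by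
    rw [Real.exp_le_one_iff]
    nlinarith [sq_nonneg (ε * a), sq_nonneg (ε * b)]
  rw [hfactor, abs_mul, Real.abs_exp]
  exact (mul_le_of_le_one_left (abs_nonneg _) hexp).trans_lt (hrem.trans_lt hδ')
end

section
/- Let s ∈ (0,1) and define the normalization constant c_{1,s} = 2^{2s} Γ((1+2s)/2) / (√π · |Γ(-s)|). Then the function y ↦ (1 - e^{-y²})/|y|^{1+2s} is Lebesgue integrable on ℝ and c_{1,s} ∫_ℝ (1 - e^{-y²})/|y|^{1+2s} dy = 2^{2s} Γ((1+2s)/2)/√π. Equivalently, the fractional Laplacian of u(x) = e^{-x²} at x = 0, defined as (-Δ)^s u(0) = -c_{1,s} p.v. ∫_ℝ (u(y) - u(0))/|y|^{1+2s} dy, equals 2^{2s} Γ((1+2s)/2)/√π. -/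
open Real MeasureTheory

/-- `x ↦ f |x|` is integrable on `ℝ` if `f` is integrable on the positive half-line. -/
lemma integrable_comp_abs_of_integrableOn_Ioi {f : ℝ → ℝ} (hf : IntegrableOn f (Set.Ioi 0)) :
    Integrable (fun x => f |x|) := by
  have hpos : IntegrableOn (fun x => f |x|) (Set.Ioi 0) :=
    hf.congr_fun (fun x hx => by rw [abs_of_pos hx]) measurableSet_Ioi
  have hneg : IntegrableOn (fun x => f |x|) (Set.Iic 0) := by
    rw [← Measure.map_neg_eq_self (volume : Measure ℝ)]
    let m : MeasurableEmbedding fun x : ℝ => -x := (Homeomorph.neg ℝ).measurableEmbedding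
    rw [m.integrableOn_map_iff]
    simp_rw [Function.comp_def, abs_neg, Set.neg_preimage, Set.neg_Iic, neg_zero]
    exact Iff.mpr integrableOn_Ici_iff_integrableOn_Ioi hpos
  rw [← integrableOn_univ, ← Set.Iic_union_Ioi (a := (0 : ℝ))]
  exact hneg.union hpos

lemma one_sub_exp_neg_sq_nonneg (y : ℝ) : 0 ≤ 1 - Real.exp (-y ^ 2) := by
  have : Real.exp (-y ^ 2) ≤ 1 := Real.exp_le_one_iff.mpr (by nlinarith [sq_nonneg y])
  linarith

lemma one_sub_exp_neg_sq_le_one (y : ℝ) : 1 - Real.exp (-y ^ 2) ≤ 1 := by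
  linarith [Real.exp_pos (-y ^ 2)]

lemma one_sub_exp_neg_sq_le_sq (y : ℝ) : 1 - Real.exp (-y ^ 2) ≤ y ^ 2 := by
  linarith [Real.add_one_le_exp (-y ^ 2)]

lemma one_sub_exp_neg_sq_mul_rpow_le {y : ℝ} (hy : 0 < y) (a : ℝ) :
    (1 - Real.exp (-y ^ 2)) * y ^ a ≤ y ^ (a + 2) := by
  rw [rpow_add hy, rpow_two, mul_comm]
  exact mul_le_mul_of_nonneg_left (one_sub_exp_neg_sq_le_sq y) (rpow_nonneg hy.le a)

lemma one_sub_exp_neg_sq_mul_rpow_le_rpow {y : ℝ} (hy : 0 < y) (a : ℝ) :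
    (1 - Real.exp (-y ^ 2)) * y ^ a ≤ y ^ a :=
  mul_le_of_le_one_left (rpow_nonneg hy.le a) (one_sub_exp_neg_sq_le_one y)

lemma integrableOn_one_sub_exp_neg_sq_mul_rpow {a : ℝ} (ha : -3 < a) (ha' : a < -1) :
    IntegrableOn (fun y : ℝ => (1 - Real.exp (-y ^ 2)) * y ^ a) (Set.Ioi 0) := by
  have hmeas : Measurable fun y : ℝ => (1 - Real.exp (-y ^ 2)) * y ^ a := by fun_prop
  have hnorm {y : ℝ} (hy : 0 < y) :
      ‖(1 - Real.exp (-y ^ 2)) * y ^ a‖ = (1 - Real.exp (-y ^ 2)) * y ^ a :=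
    Real.norm_of_nonneg (mul_nonneg (one_sub_exp_neg_sq_nonneg y) (rpow_nonneg hy.le a))
  rw [← Set.Ioc_union_Ioi_eq_Ioi (zero_le_one (α := ℝ))]
  refine IntegrableOn.union ?_ ?_
  · have h : IntegrableOn (fun y : ℝ => y ^ (a + 2)) (Set.Ioc 0 1) :=
      (intervalIntegrable_iff_integrableOn_Ioc_of_le zero_le_one).mp
        (intervalIntegral.intervalIntegrable_rpow' (by linarith))
    refine h.mono' hmeas.aestronglyMeasurable
      (ae_restrict_of_forall_mem measurableSet_Ioc fun y hy => ?_)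
    rw [hnorm hy.1]
    exact one_sub_exp_neg_sq_mul_rpow_le hy.1 a
  · refine (integrableOn_Ioi_rpow_of_lt ha' zero_lt_one).mono' hmeas.aestronglyMeasurable
      (ae_restrict_of_forall_mem measurableSet_Ioi fun y hy => ?_)
    have hy0 : 0 < y := zero_lt_one.trans hy
    rw [hnorm hy0]
    exact one_sub_exp_neg_sq_mul_rpow_le_rpow hy0 a

open Filter Topology in
lemma integral_one_sub_exp_neg_sq_mul_rpow {s : ℝ} (hs : s ∈ Set.Ioo (0 : ℝ) 1) :
    ∫ y in Set.Ioi (0 : ℝ), (1 - Real.exp (-y ^ 2)) * y ^ (-(1 + 2 * s)) =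
      Real.Gamma (1 - s) / (2 * s) := by
  obtain ⟨hs0, hs1⟩ := hs
  have hgauss {y : ℝ} (hy : 0 < y) :
      2 * y * Real.exp (-y ^ 2) * (y ^ (-(2 * s)) / -(2 * s)) =
        -s⁻¹ * (y ^ (1 - 2 * s) * Real.exp (-y ^ (2 : ℝ))) := by
    rw [rpow_two, sub_eq_add_neg, rpow_add hy, rpow_one]
    field_simp
  have hu (y : ℝ) (_ : y ∈ Set.Ioi (0 : ℝ)) : HasDerivAt (fun y : ℝ => 1 - Real.exp (-y ^ 2))
      (2 * y * Real.exp (-y ^ 2)) y := by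
    refine (((hasDerivAt_pow 2 y).fun_neg.exp).const_sub 1).congr_deriv ?_
    push_cast
    ring
  have hv (y : ℝ) (hy : y ∈ Set.Ioi (0 : ℝ)) :
      HasDerivAt (fun y : ℝ => y ^ (-(2 * s)) / -(2 * s)) (y ^ (-(1 + 2 * s))) y := by
    refine ((hasDerivAt_rpow_const (p := -(2 * s)) (Or.inl (ne_of_gt hy))).div_const
      (-(2 * s))).congr_deriv ?_
    rw [show -(2 * s) - 1 = -(1 + 2 * s) by ring, mul_div_cancel_left₀ _ (by linarith)]
  have habs {y : ℝ} (hy : 0 < y) :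
      ‖(1 - Real.exp (-y ^ 2)) * (y ^ (-(2 * s)) / -(2 * s))‖ =
        (1 - Real.exp (-y ^ 2)) * y ^ (-(2 * s)) / (2 * s) := by
    rw [div_neg, mul_neg, norm_neg, mul_div_assoc, Real.norm_of_nonneg]
    have := one_sub_exp_neg_sq_nonneg y
    positivity
  have hzero : Tendsto ((fun y : ℝ => 1 - Real.exp (-y ^ 2)) *
      fun y : ℝ => y ^ (-(2 * s)) / -(2 * s)) (𝓝[>] 0) (𝓝 0) := by
    have hlim : Tendsto (fun y : ℝ => y ^ (-(2 * s) + 2) / (2 * s)) (𝓝[>] 0) (𝓝 0) := by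
      have h := ((continuousAt_rpow_const (0 : ℝ) (-(2 * s) + 2)
        (Or.inr (by linarith))).tendsto.mono_left
          (nhdsWithin_le_nhds (s := Set.Ioi 0))).div_const (2 * s)
      rwa [zero_rpow (by linarith), zero_div] at h
    refine squeeze_zero_norm' ?_ hlim
    filter_upwards [self_mem_nhdsWithin] with y hy
    rw [Pi.mul_apply, habs hy]
    gcongr
    exact one_sub_exp_neg_sq_mul_rpow_le hy _
  have htop : Tendsto ((fun y : ℝ => 1 - Real.exp (-y ^ 2)) *
      fun y : ℝ => y ^ (-(2 * s)) / -(2 * s)) atTop (𝓝 0) := by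
    have hlim : Tendsto (fun y : ℝ => y ^ (-(2 * s)) / (2 * s)) atTop (𝓝 0) := by
      simpa using (tendsto_rpow_neg_atTop (y := 2 * s) (by linarith)).div_const (2 * s)
    refine squeeze_zero_norm' ?_ hlim
    filter_upwards [eventually_gt_atTop 0] with y hy
    rw [Pi.mul_apply, habs hy]
    gcongr
    exact one_sub_exp_neg_sq_mul_rpow_le_rpow hy _
  have hint : IntegrableOn ((fun y : ℝ => 2 * y * Real.exp (-y ^ 2)) *
      fun y : ℝ => y ^ (-(2 * s)) / -(2 * s)) (Set.Ioi 0) :=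
    IntegrableOn.congr_fun ((integrableOn_rpow_mul_exp_neg_rpow (p := 2) (s := 1 - 2 * s)
      (by linarith) two_pos).const_mul (-s⁻¹)) (fun y hy => (hgauss hy).symm) measurableSet_Ioi
  rw [integral_Ioi_mul_deriv_eq_deriv_mul hu hv
    (integrableOn_one_sub_exp_neg_sq_mul_rpow (by linarith) (by linarith)) hint hzero htop,
    setIntegral_congr_fun measurableSet_Ioi (fun y hy => hgauss hy), integral_const_mul,
    integral_rpow_mul_exp_neg_rpow two_pos (by linarith),
    show (1 - 2 * s + 1) / 2 = 1 - s by ring]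
  field_simp
  ring

lemma abs_Gamma_neg {s : ℝ} (hs : s ∈ Set.Ioo (0 : ℝ) 1) :
    |Real.Gamma (-s)| = Real.Gamma (1 - s) / s := by
  obtain ⟨hs0, hs1⟩ := hs
  have h := Real.Gamma_add_one (s := -s) (by linarith)
  have hpos : 0 < Real.Gamma (1 - s) := Real.Gamma_pos_of_pos (by linarith)
  rw [neg_add_eq_sub] at h
  have hneg : Real.Gamma (-s) = -(Real.Gamma (1 - s) / s) := by
    rw [h]
    field_simp
  rw [hneg, abs_neg, abs_of_pos (by positivity)]

/-- The fractional Laplacian of the Gaussian `u(x) = e^{-x²}` at `x = 0`: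
`y ↦ (1 - e^{-y²})/|y|^{1+2s}` is integrable and
`c_{1,s} ∫ (1 - e^{-y²})/|y|^{1+2s} dy = 2^{2s} Γ((1+2s)/2)/√π`, where
`c_{1,s} = 2^{2s} Γ((1+2s)/2)/(√π |Γ(-s)|)`. -/
theorem fractional_laplacian_gaussian_at_zero (s : ℝ) (hs : s ∈ Set.Ioo (0 : ℝ) 1) :
    Integrable (fun y : ℝ => (1 - Real.exp (-y ^ 2)) / |y| ^ (1 + 2 * s)) ∧
    (2 : ℝ) ^ (2 * s) * Real.Gamma ((1 + 2 * s) / 2) / (Real.sqrt π * |Real.Gamma (-s)|) *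
        ∫ y : ℝ, (1 - Real.exp (-y ^ 2)) / |y| ^ (1 + 2 * s)
      = (2 : ℝ) ^ (2 * s) * Real.Gamma ((1 + 2 * s) / 2) / Real.sqrt π := by
  have heven : (fun y : ℝ => (1 - Real.exp (-y ^ 2)) / |y| ^ (1 + 2 * s)) =
      fun y : ℝ => (fun t : ℝ => (1 - Real.exp (-t ^ 2)) * t ^ (-(1 + 2 * s))) |y| := by
    funext y
    simp only [sq_abs, rpow_neg (abs_nonneg y), div_eq_mul_inv]
  have hpos : 0 < Real.Gamma (1 - s) := Real.Gamma_pos_of_pos (by linarith [hs.2])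
  have hs0 : 0 < s := hs.1
  rw [heven]
  refine ⟨integrable_comp_abs_of_integrableOn_Ioi (integrableOn_one_sub_exp_neg_sq_mul_rpow
    (by linarith [hs.2]) (by linarith)), ?_⟩
  rw [integral_comp_abs (f := fun t : ℝ => (1 - Real.exp (-t ^ 2)) * t ^ (-(1 + 2 * s))),
    integral_one_sub_exp_neg_sq_mul_rpow hs, abs_Gamma_neg hs]
  field_simp
end
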